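/- Let K : 𝒟 → [0,∞), let 1 < p < ∞, and let μ and σ be locally finite positive Borel measures on ℝ^n. Then the following three quantities are equivalent, with implicit constants depending only on p (not on μ, σ, or K): (a) the dyadic energy ℰ^𝒟_{K,σ}[μ] = ∫_{ℝ^n} (∑_{Q∈𝒟} K(Q) μ(Q) χ_Q(x))^{p'} dσ(x); (b) ∫_{ℝ^n} 𝒲^𝒟_{K,σ}[μ] dμ = ∑_{Q∈𝒟} K(Q) σ(Q) μ(Q) (∫_Q K̄(Q)(y) dμ(y))^{p'−1}; (c) ∫_{ℝ^n} (M^𝒟_K[μ](x))^{p'} dσ(x), where M^𝒟_K[μ](x) = sup_{Q∈𝒟, x∈Q} (1/σ(Q)) ∑_{Q'∈𝒟, Q'⊆Q} K(Q') σ(Q') μ(Q'). -/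

import Mathlib

open MeasureTheory ENNReal Set
open scoped Classical ENNReal NNReal

noncomputable section

/-- We model `ℝ^n` as `EuclideanSpace ℝ (Fin n)`. -/
abbrev Euc (n : ℕ) := EuclideanSpace ℝ (Fin n)

/-- Indices `(k, m)` of dyadic cubes in `ℝ^n`. -/
abbrev DIdx (n : ℕ) := ℤ × (Fin n → ℤ)

/-- The dyadic cube with index `q = (k, m)`, namely `2^{-k}(m + [0,1)^n)`. -/
def dCube (n : ℕ) (q : DIdx n) : Set (Euc n) :=
  {x | ∀ i, (q.2 i : ℝ) ≤ (2:ℝ) ^ q.1 * x i ∧ (2:ℝ) ^ q.1 * x i < (q.2 i : ℝ) + 1}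

/-- The side length of the dyadic cube of index `q = (k, m)` is `2^{-k}`. -/
def sideLen (n : ℕ) (q : DIdx n) : ℝ := (2:ℝ) ^ (-q.1)

/-- Characteristic function of a dyadic cube, with values in `ℝ≥0∞`. -/
def ch (n : ℕ) (q : DIdx n) (x : Euc n) : ℝ≥0∞ := (dCube n q).indicator 1 x

/-- `K̄(Q)(x) = σ(Q)⁻¹ ∑_{Q' ⊆ Q} K(Q') σ(Q') χ_{Q'}(x)`.
(Since `σ(Q') ≤ σ(Q)` for `Q' ⊆ Q`, this is automatically `0` when `σ(Q) = 0`,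
by the convention `∞ · 0 = 0` in `ℝ≥0∞`.) -/
def Kbar (n : ℕ) (σ : Measure (Euc n)) (K : DIdx n → ℝ≥0∞) (q : DIdx n) (x : Euc n) : ℝ≥0∞ :=
  (σ (dCube n q))⁻¹ *
    ∑' q' : DIdx n, if dCube n q' ⊆ dCube n q then K q' * σ (dCube n q') * ch n q' x else 0

/-- The dyadic energy `ℰ^𝒟_{K,σ}[μ] = ∫ (∑_Q K(Q) μ(Q) χ_Q(x))^{p'} dσ(x)`, `p' = p/(p-1)`. -/
def energyD (n : ℕ) (σ μ : Measure (Euc n)) (K : DIdx n → ℝ≥0∞) (p : ℝ) : ℝ≥0∞ :=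
  ∫⁻ x, (∑' Q : DIdx n, K Q * μ (dCube n Q) * ch n Q x) ^ (p / (p - 1)) ∂σ

/-- Quantity (b): `∑_Q K(Q) σ(Q) μ(Q) (∫_Q K̄(Q)(y) dμ(y))^{p'-1} = ∫ 𝒲^𝒟_{K,σ}[μ] dμ`. -/
def wolffSumD (n : ℕ) (σ μ : Measure (Euc n)) (K : DIdx n → ℝ≥0∞) (p : ℝ) : ℝ≥0∞ :=
  ∑' Q : DIdx n, K Q * σ (dCube n Q) * μ (dCube n Q) *
    (∫⁻ y in dCube n Q, Kbar n σ K Q y ∂μ) ^ (p / (p - 1) - 1)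

/-- The dyadic maximal function
`M^𝒟_K[μ](x) = sup_{Q ∋ x} (1/σ(Q)) ∑_{Q' ⊆ Q} K(Q') σ(Q') μ(Q')`. -/
def maxFnD (n : ℕ) (σ μ : Measure (Euc n)) (K : DIdx n → ℝ≥0∞) (x : Euc n) : ℝ≥0∞ :=
  ⨆ (Q : DIdx n) (_ : x ∈ dCube n Q),
    (σ (dCube n Q))⁻¹ *
      ∑' Q' : DIdx n,
        if dCube n Q' ⊆ dCube n Q then K Q' * σ (dCube n Q') * μ (dCube n Q') else 0


section aux

lemma aux_young (t : ℝ) (ht : 0 < t) (N : ℝ≥0) (hN : N ≠ 0) (u v : ℝ≥0∞) :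
    u * v ^ t ≤ N * v ^ (t + 1) + ((N : ℝ≥0∞)⁻¹) ^ t * u ^ (t + 1) := by
  have e : ∀ w : ℝ≥0∞, w ^ (t + 1) = w * w ^ t := fun w => by
    rw [ENNReal.rpow_add_of_nonneg _ _ ht.le zero_le_one, ENNReal.rpow_one, mul_comm]
  have hN' : (N : ℝ≥0∞) ≠ 0 := by simpa using hN
  rcases le_total u (N * v) with h | h
  · refine le_trans ?_ le_self_add
    rw [e, ← mul_assoc]
    gcongr
  · refine le_trans ?_ le_add_self
    have h2 : v ≤ (N : ℝ≥0∞)⁻¹ * u := by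
      calc v = (N : ℝ≥0∞)⁻¹ * (N * v) := by
            rw [← mul_assoc, ENNReal.inv_mul_cancel hN' (by simp), one_mul]
        _ ≤ _ := by gcongr
    calc u * v ^ t ≤ u * ((N : ℝ≥0∞)⁻¹ * u) ^ t := by gcongr
      _ = _ := by rw [ENNReal.mul_rpow_of_nonneg _ _ ht.le, e]; ring

lemma aux_absorb (E A c : ℝ≥0∞) (hc : c ≤ 1 / 2) (hE : E ≠ ∞) (h : E ≤ A + c * E) :
    E ≤ 2 * A := by
  by_cases hA : A = ∞
  · simp [hA]
  have h1 : E ≤ A + 1 / 2 * E := h.trans (by gcongr)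
  lift E to ℝ≥0 using hE
  lift A to ℝ≥0 using hA
  have e : (1 / 2 : ℝ≥0∞) = ((1 / 2 : ℝ≥0) : ℝ≥0∞) := by
    rw [ENNReal.coe_div (by norm_num)]; simp
  rw [e] at h1
  norm_cast at h1 ⊢
  rw [← NNReal.coe_le_coe] at h1 ⊢
  push_cast at h1 ⊢
  linarith

lemma aux_exN (t : ℝ) (ht : 0 < t) (B : ℝ≥0) :
    ∃ N : ℝ≥0, N ≠ 0 ∧ (B : ℝ≥0∞) * ((N : ℝ≥0∞)⁻¹) ^ t ≤ 1 / 2 := by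
  refine ⟨(2 * (B + 1)) ^ (1 / t), by positivity, ?_⟩
  rw [ENNReal.inv_rpow, ENNReal.coe_rpow_of_nonneg _ (by positivity), ← ENNReal.rpow_mul,
    one_div_mul_cancel ht.ne', ENNReal.rpow_one]
  rw [← ENNReal.coe_inv (by positivity), ← ENNReal.coe_mul]
  have e : (1 / 2 : ℝ≥0∞) = ((1 / 2 : ℝ≥0) : ℝ≥0∞) := by
    rw [ENNReal.coe_div (by norm_num)]; simp
  rw [e]
  norm_cast
  rw [← NNReal.coe_le_coe]
  push_cast
  rw [← div_eq_mul_inv, div_le_div_iff₀ (by positivity) (by norm_num)]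
  linarith

lemma aux_bern (s : ℝ) (hs : 1 ≤ s) (S b : ℝ≥0∞) :
    (b + S) ^ s ≤ ENNReal.ofReal s * (b * (b + S) ^ (s - 1)) + S ^ s := by
  have hs0 : 0 < s := by linarith
  by_cases hS : S = ∞
  · simp [hS, hs0]
  by_cases hb : b = ∞
  · rcases hs.eq_or_lt with rfl | h
    · simp [hb]
    · have : (∞ : ℝ≥0∞) ^ (s - 1) = ∞ := ENNReal.top_rpow_of_pos (by linarith)
      simp [hb, this, ENNReal.mul_top, hs0]
  lift S to ℝ≥0 using hS
  lift b to ℝ≥0 using hb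
  rw [← ENNReal.coe_add, ← ENNReal.coe_rpow_of_nonneg _ hs0.le,
    ← ENNReal.coe_rpow_of_nonneg _ hs0.le, ← ENNReal.coe_rpow_of_nonneg _ (by linarith),
    ENNReal.ofReal, ← ENNReal.coe_mul, ← ENNReal.coe_mul, ← ENNReal.coe_add,
    ENNReal.coe_le_coe, ← NNReal.coe_le_coe]
  push_cast
  rw [Real.coe_toNNReal _ hs0.le]
  have hS : (0 : ℝ) ≤ S := S.coe_nonneg
  have hb : (0 : ℝ) ≤ b := b.coe_nonneg
  generalize (S : ℝ) = S at *
  generalize (b : ℝ) = b at *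
  rcases (add_nonneg hb hS).eq_or_lt with h | h
  · rw [← h, Real.zero_rpow hs0.ne']
    positivity
  have h1 := one_add_mul_self_le_rpow_one_add (s := -(b / (b + S))) (by
    rw [neg_le_neg_iff, div_le_one h]; linarith) hs
  have h2 : 1 + -(b / (b + S)) = S / (b + S) := by field_simp; ring
  rw [h2, Real.div_rpow hS h.le, le_div_iff₀ (by positivity)] at h1
  rw [Real.rpow_sub_one h.ne']
  have : s * (b * ((b + S) ^ s / (b + S))) = s * (b / (b+S)) * (b + S) ^ s := by ring
  rw [this]
  linarith

variable {X ι : Type*}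

def subF (D : ι → Set X) (F : Finset ι) (i : ι) : Finset ι := F.filter (fun j => D j ⊆ D i)

lemma aux_chain (D : ι → Set X) (b : ι → ℝ≥0∞) (s : ℝ) (hs : 1 ≤ s) (F : Finset ι) :
    (∀ i ∈ F, ∀ j ∈ F, D i ⊆ D j ∨ D j ⊆ D i) →
    (∑ i ∈ F, b i) ^ s ≤ ENNReal.ofReal s * ∑ i ∈ F, b i * (∑ j ∈ subF D F i, b j) ^ (s - 1) := by
  induction F using Finset.strongInduction with
  | H F ih =>
  intro hF
  rcases F.eq_empty_or_nonempty with rfl | hne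
  · simp [show 0 < s by linarith]
  obtain ⟨i, hi, hmax⟩ := Finset.exists_maximalFor D F hne
  have hsub : subF D F i = F := by
    apply Finset.filter_true_of_mem
    intro j hj
    rcases hF i hi j hj with h | h
    · exact hmax hj h
    · exact h
  have h1 := ih (F.erase i) (Finset.erase_ssubset hi) (fun j hj k hk =>
    hF j (Finset.mem_of_mem_erase hj) k (Finset.mem_of_mem_erase hk))
  rw [← Finset.add_sum_erase F b hi, ← Finset.add_sum_erase F _ hi]
  rw [hsub, mul_add, ← Finset.add_sum_erase F b hi]
  refine (aux_bern s hs _ _).trans ?_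
  gcongr
  refine h1.trans ?_
  gcongr with j hj
  exact Finset.filter_subset_filter _ (Finset.erase_subset _ _)

def ff (D : ι → Set X) (a : ι → ℝ≥0∞) (F : Finset ι) (x : X) : ℝ≥0∞ :=
  ∑ i ∈ F, a i * (D i).indicator 1 x

lemma ff_eq (D : ι → Set X) (a : ι → ℝ≥0∞) (F : Finset ι) (x : X) :
    ff D a F x = ∑ i ∈ F.filter (fun i => x ∈ D i), a i := by
  rw [Finset.sum_filter, ff]
  refine Finset.sum_congr rfl fun i _ => ?_
  by_cases h : x ∈ D i <;> simp [h]

lemma ff_mono (D : ι → Set X) (a : ι → ℝ≥0∞) {F G : Finset ι} (h : F ⊆ G) (x : X) :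
    ff D a F x ≤ ff D a G x := Finset.sum_le_sum_of_subset h

lemma ff_chain (D : ι → Set X) (hD : ∀ i j x, x ∈ D i → x ∈ D j → D i ⊆ D j ∨ D j ⊆ D i)
    (a : ι → ℝ≥0∞) (s : ℝ) (hs : 1 ≤ s) (F : Finset ι) (x : X) :
    (ff D a F x) ^ s ≤ ENNReal.ofReal s *
      ∑ i ∈ F, a i * ((D i).indicator 1 x * (ff D a (subF D F i) x) ^ (s - 1)) := by
  rw [ff_eq]
  refine (aux_chain D a s hs _ ?_).trans ?_
  · intro i hi j hj
    exact hD i j x (Finset.mem_filter.1 hi).2 (Finset.mem_filter.1 hj).2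
  rw [Finset.sum_filter]
  gcongr with i hi
  by_cases h : x ∈ D i
  · simp only [h, if_true, indicator_of_mem, Pi.one_apply, one_mul]
    rw [ff_eq]
    gcongr
    intro j hj
    simp only [subF, Finset.mem_filter] at hj ⊢
    tauto
  · simp [h]

variable [MeasurableSpace X]

lemma ff_meas (D : ι → Set X) (hm : ∀ i, MeasurableSet (D i)) (a : ι → ℝ≥0∞) (F : Finset ι) :
    Measurable (ff D a F) := by
  unfold ff
  exact Finset.measurable_sum _ fun i _ => (measurable_one.indicator (hm i)).const_mul _

lemma ff_lint (σ : Measure X) (D : ι → Set X) (hm : ∀ i, MeasurableSet (D i)) (a : ι → ℝ≥0∞)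
    (F : Finset ι) : ∫⁻ x, ff D a F x ∂σ = ∑ i ∈ F, a i * σ (D i) := by
  unfold ff
  rw [lintegral_finsetSum _ fun i _ => (measurable_one.indicator (hm i)).const_mul _]
  refine Finset.sum_congr rfl fun i _ => ?_
  rw [lintegral_const_mul _ (measurable_one.indicator (hm i)), lintegral_indicator_one (hm i)]

lemma ff_fin (σ : Measure X) (D : ι → Set X) (hm : ∀ i, MeasurableSet (D i))
    (hf : ∀ i, σ (D i) ≠ ∞) (a : ι → ℝ≥0∞) (ha : ∀ i, a i ≠ ∞) (s : ℝ) (hs : 0 < s)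
    (F : Finset ι) : ∫⁻ x, (ff D a F x) ^ s ∂σ ≠ ∞ := by
  have hU : MeasurableSet (⋃ i ∈ F, D i) := F.measurableSet_biUnion fun i _ => hm i
  have h : ∀ x, (ff D a F x) ^ s ≤
      (∑ i ∈ F, a i) ^ s * (⋃ i ∈ F, D i).indicator 1 x := by
    intro x
    by_cases hx : x ∈ ⋃ i ∈ F, D i
    · simp only [hx, indicator_of_mem, Pi.one_apply, mul_one]
      rw [ff_eq]
      gcongr
      exact Finset.filter_subset _ _
    · have : F.filter (fun i => x ∈ D i) = ∅ := by
        ext i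
        simp only [mem_iUnion, not_exists] at hx
        simpa using hx i
      simp [ff_eq, this, hs]
  refine ne_top_of_le_ne_top ?_ (lintegral_mono h)
  rw [lintegral_const_mul _ (measurable_one.indicator hU), lintegral_indicator_one hU]
  refine ENNReal.mul_ne_top ?_ ?_
  · exact ENNReal.rpow_ne_top_of_nonneg hs.le (ENNReal.sum_ne_top.2 fun i _ => ha i)
  · refine ne_top_of_le_ne_top (ENNReal.sum_ne_top.2 fun i (_ : i ∈ F) => hf i)
      (measure_biUnion_finset_le F D)

def mm (σ : Measure X) (D : ι → Set X) (a : ι → ℝ≥0∞) (F : Finset ι) (i : ι) : ℝ≥0∞ :=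
  (σ (D i))⁻¹ * ∑ j ∈ subF D F i, a j * σ (D j)

def WW (σ : Measure X) (D : ι → Set X) (a : ι → ℝ≥0∞) (s : ℝ) (F : Finset ι) : ℝ≥0∞ :=
  ∑ i ∈ F, a i * (σ (D i) * (mm σ D a F i) ^ (s - 1))

lemma mm_fin (σ : Measure X) (D : ι → Set X) (hf : ∀ i, σ (D i) ≠ ∞) (a : ι → ℝ≥0∞)
    (ha : ∀ i, a i ≠ ∞) (F : Finset ι) (i : ι) : mm σ D a F i ≠ ∞ := by
  unfold mm
  by_cases h : σ (D i) = 0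
  · have : ∑ j ∈ subF D F i, a j * σ (D j) = 0 := by
      refine Finset.sum_eq_zero fun j hj => ?_
      rw [measure_mono_null (Finset.mem_filter.1 hj).2 h, mul_zero]
    simp [this]
  · exact ENNReal.mul_ne_top (ENNReal.inv_ne_top.2 h)
      (ENNReal.sum_ne_top.2 fun j _ => ENNReal.mul_ne_top (ha j) (hf j))

lemma mm_mul (σ : Measure X) (D : ι → Set X) (hf : ∀ i, σ (D i) ≠ ∞) (a : ι → ℝ≥0∞)
    (F : Finset ι) (i : ι) : σ (D i) * mm σ D a F i = ∑ j ∈ subF D F i, a j * σ (D j) := by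
  unfold mm
  by_cases h : σ (D i) = 0
  · have : ∑ j ∈ subF D F i, a j * σ (D j) = 0 := by
      refine Finset.sum_eq_zero fun j hj => ?_
      rw [measure_mono_null (Finset.mem_filter.1 hj).2 h, mul_zero]
    simp [this]
  · rw [← mul_assoc, ENNReal.mul_inv_cancel h (hf i), one_mul]

lemma WW_fin (σ : Measure X) (D : ι → Set X) (hf : ∀ i, σ (D i) ≠ ∞) (a : ι → ℝ≥0∞)
    (ha : ∀ i, a i ≠ ∞) (s : ℝ) (hs : 1 ≤ s) (F : Finset ι) : WW σ D a s F ≠ ∞ := by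
  refine ENNReal.sum_ne_top.2 fun i _ => ENNReal.mul_ne_top (ha i) (ENNReal.mul_ne_top (hf i) ?_)
  exact ENNReal.rpow_ne_top_of_nonneg (by linarith) (mm_fin σ D hf a ha F i)

lemma energy_chain (σ : Measure X) (D : ι → Set X) (hm : ∀ i, MeasurableSet (D i))
    (hD : ∀ i j x, x ∈ D i → x ∈ D j → D i ⊆ D j ∨ D j ⊆ D i)
    (a : ι → ℝ≥0∞) (s : ℝ) (hs : 1 ≤ s) (F : Finset ι) :
    ∫⁻ x, (ff D a F x) ^ s ∂σ ≤ ENNReal.ofReal s *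
      ∑ i ∈ F, a i * ∫⁻ x in D i, (ff D a (subF D F i) x) ^ (s - 1) ∂σ := by
  refine (lintegral_mono fun x => ff_chain D hD a s hs F x).trans ?_
  have h1 : ∀ i, Measurable fun x => (D i).indicator 1 x * (ff D a (subF D F i) x) ^ (s - 1) :=
    fun i => (measurable_one.indicator (hm i)).mul ((ff_meas D hm a _).pow_const _)
  rw [lintegral_const_mul _ (Finset.measurable_sum _ fun i _ => (h1 i).const_mul _),
    lintegral_finsetSum _ fun i _ => (h1 i).const_mul _]
  gcongr with i hi
  rw [lintegral_const_mul _ (h1 i), ← lintegral_indicator (hm i)]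
  gcongr with x
  by_cases h : x ∈ D i <;> simp [h]

lemma jensen_aux (σ : Measure X) (f : X → ℝ≥0∞) (hf : Measurable f)
    (t : ℝ) (ht : 0 < t) (ht1 : t ≤ 1) :
    ∫⁻ x, f x ^ t ∂σ ≤ (σ univ) ^ (1 - t) * (∫⁻ x, f x ∂σ) ^ t := by
  rcases ht1.eq_or_lt with rfl | h
  · simp
  have hc : (1 / t).HolderConjugate (1 / (1 - t)) := by
    rw [Real.holderConjugate_iff]
    refine ⟨by rw [lt_div_iff₀ ht]; linarith, by simp⟩
  have := ENNReal.lintegral_mul_le_Lp_mul_Lq σ hc (f := fun x => f x ^ t) (g := fun _ => 1)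
    (hf.pow_const _).aemeasurable aemeasurable_const
  simp only [Pi.mul_apply, mul_one, ← ENNReal.rpow_mul, one_div_one_div, ENNReal.one_rpow,
    lintegral_const, one_mul] at this
  rw [mul_one_div_cancel ht.ne'] at this
  simp only [ENNReal.rpow_one] at this
  rwa [mul_comm]

lemma sub_lint (σ : Measure X) (D : ι → Set X) (hm : ∀ i, MeasurableSet (D i)) (a : ι → ℝ≥0∞)
    (F : Finset ι) (i : ι) :
    ∫⁻ x in D i, ff D a (subF D F i) x ∂σ = ∑ j ∈ subF D F i, a j * σ (D j) := by
  rw [ff_lint _ _ hm]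
  refine Finset.sum_congr rfl fun j hj => ?_
  rw [Measure.restrict_apply (hm j), inter_eq_left.2 (Finset.mem_filter.1 hj).2]

lemma energy_base (σ : Measure X) (D : ι → Set X) (hm : ∀ i, MeasurableSet (D i))
    (hf : ∀ i, σ (D i) ≠ ∞)
    (hD : ∀ i j x, x ∈ D i → x ∈ D j → D i ⊆ D j ∨ D j ⊆ D i)
    (a : ι → ℝ≥0∞) (s : ℝ) (hs : 1 < s) (hs2 : s ≤ 2) (F : Finset ι) :
    ∫⁻ x, (ff D a F x) ^ s ∂σ ≤ ENNReal.ofReal s * WW σ D a s F := by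
  refine (energy_chain σ D hm hD a s hs.le F).trans ?_
  unfold WW
  gcongr with i hi
  refine (jensen_aux _ _ (ff_meas D hm a _) (s - 1) (by linarith)
    (by linarith)).trans ?_
  rw [sub_lint σ D hm, ← mm_mul σ D hf, Measure.restrict_apply_univ,
    ENNReal.mul_rpow_of_nonneg _ _ (by linarith), ← mul_assoc,
    ← ENNReal.rpow_add_of_nonneg _ _ (by linarith) (by linarith)]
  simp

lemma subF_subF (D : ι → Set X) (F : Finset ι) {i j : ι} (hj : j ∈ subF D F i) :
    subF D (subF D F i) j = subF D F j := by
  have h := (Finset.mem_filter.1 hj).2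
  ext k
  simp only [subF, Finset.mem_filter]
  constructor
  · tauto
  · rintro ⟨h1, h2⟩
    exact ⟨⟨h1, h2.trans h⟩, h2⟩

lemma lint_weight (σ : Measure X) (D : ι → Set X) (hm : ∀ i, MeasurableSet (D i))
    (a c : ι → ℝ≥0∞) (F : Finset ι) :
    ∑ i ∈ F, a i * (σ (D i) * c i) = ∫⁻ x, ff D (fun i => a i * c i) F x ∂σ := by
  rw [ff_lint σ D hm]
  refine Finset.sum_congr rfl fun i _ => by ring

lemma energy_step (s : ℝ) (hs : 2 < s) (C : ℝ≥0) : ∃ C' : ℝ≥0,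
    ∀ (X ι : Type) [MeasurableSpace X] (σ : Measure X) (D : ι → Set X) (_ : ∀ i, MeasurableSet (D i))
    (_ : ∀ i, σ (D i) ≠ ∞)
    (_ : ∀ i j x, x ∈ D i → x ∈ D j → D i ⊆ D j ∨ D j ⊆ D i)
    (a : ι → ℝ≥0∞) (_ : ∀ i, a i ≠ ∞)
    (_ : ∀ F : Finset ι, ∫⁻ x, (ff D a F x) ^ (s - 1) ∂σ ≤ C * WW σ D a (s - 1) F)
    (F : Finset ι), ∫⁻ x, (ff D a F x) ^ s ∂σ ≤ C' * WW σ D a s F := by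
  obtain ⟨N, hN0, hN⟩ := aux_exN (s - 2) (by linarith) (s.toNNReal * C)
  refine ⟨2 * (s.toNNReal * C * N), ?_⟩
  intro X ι _ σ D hm hf hD a ha hP F
  have h1 : ∫⁻ x, (ff D a F x) ^ s ∂σ ≤ ENNReal.ofReal s * (C *
      ∫⁻ x, ff D a F x * ff D (fun i => a i * (mm σ D a F i) ^ (s - 2)) F x ∂σ) := by
    refine (energy_chain σ D hm hD a s (by linarith) F).trans ?_
    gcongr
    calc ∑ i ∈ F, a i * ∫⁻ x in D i, (ff D a (subF D F i) x) ^ (s - 1) ∂σ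
        ≤ ∑ i ∈ F, a i * (C * ∫⁻ x, (D i).indicator 1 x *
            ff D (fun i => a i * (mm σ D a F i) ^ (s - 2)) F x ∂σ) := by
          gcongr with i hi
          refine (setLIntegral_le_lintegral _ _).trans ((hP _).trans ?_)
          gcongr
          have : WW σ D a (s - 1) (subF D F i) = 
              ∑ j ∈ subF D F i, a j * (σ (D j) * (mm σ D a F j) ^ (s - 2)) := by
            refine Finset.sum_congr rfl fun j hj => ?_
            rw [show s - 1 - 1 = s - 2 by ring]
            simp only [mm, subF_subF D F hj]
          rw [this, lint_weight σ D hm]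
          gcongr with x
          by_cases hx : x ∈ D i
          · simp only [hx, indicator_of_mem, Pi.one_apply, one_mul]
            exact ff_mono _ _ (Finset.filter_subset _ _) _
          · rw [ff_eq, Finset.filter_eq_empty_iff.2]
            · simp
            · intro j hj hxj
              exact hx ((Finset.mem_filter.1 hj).2 hxj)
      _ = C * ∫⁻ x, ff D a F x * ff D (fun i => a i * (mm σ D a F i) ^ (s - 2)) F x ∂σ := by
          have : ∀ x, ff D a F x * ff D (fun i => a i * (mm σ D a F i) ^ (s - 2)) F x =
            ∑ i ∈ F, a i * ((D i).indicator 1 x *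
              ff D (fun i => a i * (mm σ D a F i) ^ (s - 2)) F x) := by
            intro x
            conv_lhs => rw [ff, Finset.sum_mul]
            refine Finset.sum_congr rfl fun i _ => by rw [mul_assoc]
          simp only [this]
          have h1 : ∀ i, Measurable fun x => (D i).indicator 1 x *
              ff D (fun i => a i * (mm σ D a F i) ^ (s - 2)) F x :=
            fun i => (measurable_one.indicator (hm i)).mul (ff_meas D hm _ _)
          rw [lintegral_finsetSum _ fun i _ => (h1 i).const_mul _, Finset.mul_sum]
          refine Finset.sum_congr rfl fun i _ => ?_
          rw [lintegral_const_mul _ (h1 i)]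
          ring
  have h2 : ∫⁻ x, ff D a F x * ff D (fun i => a i * (mm σ D a F i) ^ (s - 2)) F x ∂σ ≤
      N * WW σ D a s F + ((N : ℝ≥0∞)⁻¹) ^ (s - 2) * ∫⁻ x, (ff D a F x) ^ s ∂σ := by
    have : WW σ D a s F = ∫⁻ x, ff D (fun i => a i * (mm σ D a F i) ^ (s - 1)) F x ∂σ :=
      lint_weight σ D hm a _ F
    rw [this, ← lintegral_const_mul _ (ff_meas D hm _ _),
      ← lintegral_const_mul _ ((ff_meas D hm _ _).pow_const _),
      ← lintegral_add_left ((ff_meas D hm _ _).const_mul _)]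
    refine lintegral_mono fun x => ?_
    dsimp only
    have e : (ff D a F x) ^ s = ff D a F x * (ff D a F x) ^ (s - 1) := by
      conv_lhs => rw [show s = 1 + (s - 1) by ring,
        ENNReal.rpow_add_of_nonneg _ _ zero_le_one (by linarith), ENNReal.rpow_one]
    rw [e]
    set f := ff D a F x with hfx
    calc f * ff D (fun i => a i * (mm σ D a F i) ^ (s - 2)) F x
        = ∑ i ∈ F, a i * (D i).indicator 1 x * (f * (mm σ D a F i) ^ (s - 2)) := by
          rw [ff, Finset.mul_sum]
          refine Finset.sum_congr rfl fun i _ => by ring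
      _ ≤ ∑ i ∈ F, a i * (D i).indicator 1 x * (N * (mm σ D a F i) ^ (s - 1) +
            ((N : ℝ≥0∞)⁻¹) ^ (s - 2) * f ^ (s - 1)) := by
          gcongr with i hi
          have := aux_young (s - 2) (by linarith) N hN0 f (mm σ D a F i)
          rwa [show s - 2 + 1 = s - 1 by ring] at this
      _ = _ := by
          have : ((N : ℝ≥0∞)⁻¹) ^ (s - 2) * (f * f ^ (s - 1)) = 
            ∑ i ∈ F, a i * (D i).indicator 1 x * (((N : ℝ≥0∞)⁻¹) ^ (s - 2) * f ^ (s - 1)) := by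
            rw [← Finset.sum_mul]
            change _ = f * _
            ring
          rw [this, ff, Finset.mul_sum, ← Finset.sum_add_distrib]
          refine Finset.sum_congr rfl fun i _ => by ring
  have h3 := h1.trans (mul_le_mul_right (mul_le_mul_right h2 _) _)
  have h4 := aux_absorb _ (s.toNNReal * C * N * WW σ D a s F) _ hN
    (ff_fin σ D hm hf a ha s (by linarith) F) (h3.trans (le_of_eq (by
      rw [ENNReal.ofReal]; push_cast; ring)))
  refine h4.trans (le_of_eq ?_)
  push_cast; ring

lemma energy_le (k : ℕ) : ∀ (s : ℝ), 1 < s → s ≤ k + 2 →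
    ∃ C : ℝ≥0,
    ∀ (X ι : Type) [MeasurableSpace X] (σ : Measure X) (D : ι → Set X) (_ : ∀ i, MeasurableSet (D i))
    (_ : ∀ i, σ (D i) ≠ ∞)
    (_ : ∀ i j x, x ∈ D i → x ∈ D j → D i ⊆ D j ∨ D j ⊆ D i)
    (a : ι → ℝ≥0∞) (_ : ∀ i, a i ≠ ∞)
    (F : Finset ι), ∫⁻ x, (ff D a F x) ^ s ∂σ ≤ C * WW σ D a s F := by
  induction k with
  | zero =>
    intro s hs hs2
    exact ⟨s.toNNReal, fun X ι _ σ D hm hf hD a ha F =>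
      energy_base σ D hm hf hD a s hs (by simpa using hs2) F⟩
  | succ k ih =>
    intro s hs hs2
    by_cases h2 : s ≤ 2
    · exact ⟨s.toNNReal, fun X ι _ σ D hm hf hD a ha F => energy_base σ D hm hf hD a s hs h2 F⟩
    · push Not at h2
      push_cast at hs2
      obtain ⟨C, hC⟩ := ih (s - 1) (by linarith) (by linarith)
      obtain ⟨C', hC'⟩ := energy_step s h2 C
      exact ⟨C', fun X ι _ σ D hm hf hD a ha F => hC' X ι σ D hm hf hD a ha (hC X ι σ D hm hf hD a ha) F⟩

def MM (σ : Measure X) (D : ι → Set X) (a : ι → ℝ≥0∞) (F : Finset ι) (x : X) : ℝ≥0∞ :=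
  ⨆ i ∈ F, mm σ D a F i * (D i).indicator 1 x

lemma MM_meas (σ : Measure X) (D : ι → Set X) (hm : ∀ i, MeasurableSet (D i)) (a : ι → ℝ≥0∞)
    (F : Finset ι) : Measurable (MM σ D a F) := by
  unfold MM
  exact Measurable.biSup _ F.countable_toSet
    fun i _ => (measurable_one.indicator (hm i)).const_mul _

lemma WW_le (s : ℝ) (hs : 1 < s) (C : ℝ≥0) : ∃ C' : ℝ≥0,
    ∀ (X ι : Type) [MeasurableSpace X] (σ : Measure X) (D : ι → Set X) (_ : ∀ i, MeasurableSet (D i))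
    (_ : ∀ i, σ (D i) ≠ ∞)
    (a : ι → ℝ≥0∞) (_ : ∀ i, a i ≠ ∞) (F : Finset ι)
    (_ : ∫⁻ x, (ff D a F x) ^ s ∂σ ≤ C * WW σ D a s F),
    WW σ D a s F ≤ C' * ∫⁻ x, (MM σ D a F x) ^ s ∂σ := by
  obtain ⟨N, hN0, hN⟩ := aux_exN (s - 1) (by linarith) C
  refine ⟨2 * N, ?_⟩
  intro X ι _ σ D hm hf a ha F hP
  have h1 : WW σ D a s F ≤ N * (∫⁻ x, (MM σ D a F x) ^ s ∂σ) +
      ((N : ℝ≥0∞)⁻¹) ^ (s - 1) * ∫⁻ x, (ff D a F x) ^ s ∂σ := by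
    have : WW σ D a s F = ∫⁻ x, ff D (fun i => a i * (mm σ D a F i) ^ (s - 1)) F x ∂σ :=
      lint_weight σ D hm a _ F
    rw [this, ← lintegral_const_mul _ ((MM_meas σ D hm _ _).pow_const _),
      ← lintegral_const_mul _ ((ff_meas D hm _ _).pow_const _),
      ← lintegral_add_left (((MM_meas σ D hm _ _).pow_const _).const_mul _)]
    refine lintegral_mono fun x => ?_
    have := aux_young (s - 1) (by linarith) N hN0 (ff D a F x) (MM σ D a F x)
    rw [sub_add_cancel] at this
    refine le_trans ?_ this
    rw [ff, ff, Finset.sum_mul]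
    refine Finset.sum_le_sum fun i hi => ?_
    by_cases hx : x ∈ D i
    · simp only [hx, indicator_of_mem, Pi.one_apply, mul_one]
      gcongr
      refine le_trans ?_ (le_iSup₂ (f := fun i (_ : i ∈ F) =>
        mm σ D a F i * (D i).indicator 1 x) i hi)
      simp [hx]
    · simp [hx]
  have h2 := aux_absorb _ _ _ hN (WW_fin σ D hf a ha s hs.le F)
    (h1.trans (add_le_add_right (le_trans (mul_le_mul_right hP _) (le_of_eq (by ring))) _))
  refine h2.trans (le_of_eq ?_)
  push_cast; ring

lemma weak_aux (σ ν : Measure X) (D : ι → Set X) (hm : ∀ i, MeasurableSet (D i))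
    (hD : ∀ i j x, x ∈ D i → x ∈ D j → D i ⊆ D j ∨ D j ⊆ D i) (t : ℝ≥0∞) (G : Finset ι) :
    (∀ i ∈ G, t * σ (D i) ≤ ν (D i)) → t * σ (⋃ i ∈ G, D i) ≤ ν (⋃ i ∈ G, D i) := by
  induction G using Finset.strongInduction with
  | H G ih =>
  intro hG
  rcases G.eq_empty_or_nonempty with rfl | hne
  · simp
  obtain ⟨i, hi, hmax⟩ := Finset.exists_maximalFor D G hne
  set G' := G.filter (fun j => ¬ D j ⊆ D i) with hG'
  have hss : G' ⊂ G := by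
    refine (Finset.filter_ssubset).2 ⟨i, hi, by simp⟩
  have hU : (⋃ j ∈ G, D j) = D i ∪ ⋃ j ∈ G', D j := by
    ext x
    simp only [mem_iUnion, mem_union, exists_prop, hG', Finset.mem_filter]
    constructor
    · rintro ⟨j, hj, hx⟩
      by_cases h : D j ⊆ D i
      · exact Or.inl (h hx)
      · exact Or.inr ⟨j, ⟨hj, h⟩, hx⟩
    · rintro (h | ⟨j, ⟨hj, _⟩, hx⟩)
      · exact ⟨i, hi, h⟩
      · exact ⟨j, hj, hx⟩
  have hdis : Disjoint (D i) (⋃ j ∈ G', D j) := by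
    rw [Set.disjoint_left]
    intro x hx hx'
    simp only [mem_iUnion, exists_prop, hG', Finset.mem_filter] at hx'
    obtain ⟨j, ⟨hj, hn⟩, hxj⟩ := hx'
    rcases hD i j x hx hxj with h | h
    · exact hn (hmax hj h)
    · exact hn h
  have hmU : MeasurableSet (⋃ j ∈ G', D j) := G'.measurableSet_biUnion fun i _ => hm i
  rw [hU, measure_union hdis hmU, measure_union hdis hmU, mul_add]
  exact add_le_add (hG i hi) (ih G' hss fun j hj => hG j (hss.1 hj))

lemma MM_le_ff (σ : Measure X) (D : ι → Set X) (a : ι → ℝ≥0∞) (F : Finset ι) (x : X) :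
    MM σ D a F x ≤ ff D (mm σ D a F) F x := by
  refine iSup₂_le fun i hi => ?_
  exact Finset.single_le_sum (f := fun i => mm σ D a F i * (D i).indicator 1 x)
    (fun _ _ => zero_le) hi

lemma MM_fin (σ : Measure X) (D : ι → Set X) (hf : ∀ i, σ (D i) ≠ ∞) (a : ι → ℝ≥0∞)
    (ha : ∀ i, a i ≠ ∞) (F : Finset ι) (x : X) : MM σ D a F x ≠ ∞ := by
  refine ne_top_of_le_ne_top ?_ (MM_le_ff σ D a F x)
  rw [ff_eq]
  exact ENNReal.sum_ne_top.2 fun i _ => mm_fin σ D hf a ha F i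

lemma max_weak (σ : Measure X) (D : ι → Set X) (hm : ∀ i, MeasurableSet (D i))
    (hf : ∀ i, σ (D i) ≠ ∞)
    (hD : ∀ i j x, x ∈ D i → x ∈ D j → D i ⊆ D j ∨ D j ⊆ D i)
    (a : ι → ℝ≥0∞) (ha : ∀ i, a i ≠ ∞) (F : Finset ι) (t : ℝ) (ht : 0 < t) :
    ENNReal.ofReal t * σ {x | t < (MM σ D a F x).toReal} ≤
      (σ.withDensity (ff D a F)) {x | t < (MM σ D a F x).toReal} := by
  have hset : {x | t < (MM σ D a F x).toReal} =
      ⋃ i ∈ F.filter (fun i => ENNReal.ofReal t < mm σ D a F i), D i := by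
    ext x
    simp only [mem_ofPred_eq, mem_iUnion, exists_prop, Finset.mem_filter]
    rw [← ENNReal.ofReal_lt_iff_lt_toReal ht.le (MM_fin σ D hf a ha F x), MM]
    simp only [lt_iSup_iff, exists_prop]
    refine exists_congr fun i => ?_
    by_cases hx : x ∈ D i <;> simp [hx]
  rw [hset]
  refine weak_aux _ _ D hm hD _ _ fun i hi => ?_
  rw [withDensity_apply _ (hm i)]
  calc ENNReal.ofReal t * σ (D i) ≤ mm σ D a F i * σ (D i) := by
        gcongr
        exact (Finset.mem_filter.1 hi).2.le
    _ = ∫⁻ x in D i, ff D a (subF D F i) x ∂σ := by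
        rw [mul_comm, mm_mul σ D hf, sub_lint σ D hm]
    _ ≤ _ := by
        gcongr with x
        exact ff_mono _ _ (Finset.filter_subset _ _) _

lemma maxfn_le (s : ℝ) (hs : 1 < s) : ∃ C : ℝ≥0,
    ∀ (X ι : Type) [MeasurableSpace X] (σ : Measure X) (D : ι → Set X)
    (_ : ∀ i, MeasurableSet (D i)) (_ : ∀ i, σ (D i) ≠ ∞)
    (_ : ∀ i j x, x ∈ D i → x ∈ D j → D i ⊆ D j ∨ D j ⊆ D i)
    (a : ι → ℝ≥0∞) (_ : ∀ i, a i ≠ ∞) (F : Finset ι),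
    ∫⁻ x, (MM σ D a F x) ^ s ∂σ ≤ C * ∫⁻ x, (ff D a F x) ^ s ∂σ := by
  set c : ℝ≥0 := s.toNNReal / (s - 1).toNNReal with hc
  set N : ℝ≥0 := 1 / (2 * (c + 1)) with hN
  have hN0 : N ≠ 0 := by positivity
  have hcN : (c : ℝ≥0∞) * N ≤ 1 / 2 := by
    have e : (1 / 2 : ℝ≥0∞) = ((1 / 2 : ℝ≥0) : ℝ≥0∞) := by
      rw [ENNReal.coe_div (by norm_num)]; simp
    rw [e]
    norm_cast
    rw [hN, ← NNReal.coe_le_coe]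
    push_cast
    rw [mul_one_div, div_le_div_iff₀ (by positivity) (by norm_num)]
    linarith
  refine ⟨2 * (c * (N⁻¹) ^ (s - 1)), ?_⟩
  intro X ι _ σ D hm hf hD a ha F
  have hMm := MM_meas σ D hm a F
  have hpow : ∀ (r : ℝ), 0 ≤ r → ∀ x, ENNReal.ofReal ((MM σ D a F x).toReal ^ r) =
      (MM σ D a F x) ^ r := fun r hr x => by
    rw [← ENNReal.ofReal_rpow_of_nonneg ENNReal.toReal_nonneg hr,
      ENNReal.ofReal_toReal (MM_fin σ D hf a ha F x)]
  have hA := lintegral_rpow_eq_lintegral_meas_lt_mul σ (f := fun x => (MM σ D a F x).toReal)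
    (Filter.Eventually.of_forall fun x => ENNReal.toReal_nonneg) hMm.ennreal_toReal.aemeasurable
    (p := s) (by linarith)
  have hB := lintegral_rpow_eq_lintegral_meas_lt_mul (σ.withDensity (ff D a F))
    (f := fun x => (MM σ D a F x).toReal)
    (Filter.Eventually.of_forall fun x => ENNReal.toReal_nonneg) hMm.ennreal_toReal.aemeasurable
    (p := s - 1) (by linarith)
  simp only [hpow s (by linarith)] at hA
  simp only [hpow (s - 1) (by linarith)] at hB
  rw [lintegral_withDensity_eq_lintegral_mul _ (ff_meas D hm a F) (hMm.pow_const _)] at hB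
  simp only [Pi.mul_apply] at hB
  have hAB : (∫⁻ t in Ioi (0 : ℝ), σ {x | t < (MM σ D a F x).toReal} *
        ENNReal.ofReal (t ^ (s - 1))) ≤
      ∫⁻ t in Ioi (0 : ℝ), (σ.withDensity (ff D a F)) {x | t < (MM σ D a F x).toReal} *
        ENNReal.ofReal (t ^ (s - 1 - 1)) := by
    refine setLIntegral_mono' measurableSet_Ioi fun t ht => ?_
    have ht : 0 < t := ht
    have : t ^ (s - 1) = t * t ^ (s - 1 - 1) := by
      rw [Real.rpow_sub_one ht.ne' (s - 1)]; field_simp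
    rw [this, ENNReal.ofReal_mul ht.le, ← mul_assoc, mul_comm (σ _)]
    gcongr
    exact max_weak σ D hm hf hD a ha F t ht
  have hs1 : (s - 1).toNNReal ≠ 0 := by
    rw [Ne, Real.toNNReal_eq_zero]; linarith
  have h1 : ∫⁻ x, (MM σ D a F x) ^ s ∂σ ≤ c * ∫⁻ x, ff D a F x * (MM σ D a F x) ^ (s - 1) ∂σ := by
    rw [hA, hB, ← mul_assoc]
    have : (c : ℝ≥0∞) * ENNReal.ofReal (s - 1) = ENNReal.ofReal s := by
      rw [ENNReal.ofReal, ENNReal.ofReal, ← ENNReal.coe_mul, hc, div_mul_cancel₀ _ hs1]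
    rw [this]
    gcongr
  have h2 : ∫⁻ x, ff D a F x * (MM σ D a F x) ^ (s - 1) ∂σ ≤
      N * (∫⁻ x, (MM σ D a F x) ^ s ∂σ) +
      ((N : ℝ≥0∞)⁻¹) ^ (s - 1) * ∫⁻ x, (ff D a F x) ^ s ∂σ := by
    rw [← lintegral_const_mul _ ((MM_meas σ D hm _ _).pow_const _),
      ← lintegral_const_mul _ ((ff_meas D hm _ _).pow_const _),
      ← lintegral_add_left (((MM_meas σ D hm _ _).pow_const _).const_mul _)]
    refine lintegral_mono fun x => ?_
    have := aux_young (s - 1) (by linarith) N hN0 (ff D a F x) (MM σ D a F x)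
    rwa [sub_add_cancel] at this
  have hfin : ∫⁻ x, (MM σ D a F x) ^ s ∂σ ≠ ∞ := by
    refine ne_top_of_le_ne_top (ff_fin σ D hm hf (mm σ D a F) (mm_fin σ D hf a ha F) s
      (by linarith) F) (lintegral_mono fun x => ?_)
    exact ENNReal.rpow_le_rpow (MM_le_ff σ D a F x) (by linarith)
  have h3 := aux_absorb _ (c * (((N : ℝ≥0∞)⁻¹) ^ (s - 1) * ∫⁻ x, (ff D a F x) ^ s ∂σ)) _ hcN hfin
    ((h1.trans (mul_le_mul_right h2 _)).trans (le_of_eq (by ring)))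
  refine h3.trans (le_of_eq ?_)
  rw [ENNReal.coe_mul, ENNReal.coe_mul, ENNReal.coe_rpow_of_nonneg _ (by linarith),
    ENNReal.coe_inv hN0]
  push_cast; ring

lemma rpow_iSup_aux {κ : Type*} (f : κ → ℝ≥0∞) (s : ℝ) (hs : 0 < s) :
    (⨆ k, f k) ^ s = ⨆ k, (f k) ^ s :=
  (ENNReal.orderIsoRpow s hs).map_iSup f

lemma lim_energy [Countable ι] (σ : Measure X) (D : ι → Set X) (hm : ∀ i, MeasurableSet (D i))
    (a : ι → ℝ≥0∞) (s : ℝ) (hs : 0 < s) :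
    ∫⁻ x, (∑' i, a i * (D i).indicator 1 x) ^ s ∂σ = ⨆ F, ∫⁻ x, (ff D a F x) ^ s ∂σ := by
  rw [← lintegral_iSup_directed]
  · refine lintegral_congr fun x => ?_
    rw [ENNReal.tsum_eq_iSup_sum, rpow_iSup_aux _ _ hs]
    rfl
  · exact fun F => ((ff_meas D hm a F).pow_const _).aemeasurable
  · refine Monotone.directed_le fun F G h x => ?_
    exact ENNReal.rpow_le_rpow (ff_mono D a h x) hs.le

lemma mm_mono (σ : Measure X) (D : ι → Set X) (a : ι → ℝ≥0∞) {F G : Finset ι} (h : F ⊆ G)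
    (i : ι) : mm σ D a F i ≤ mm σ D a G i := by
  unfold mm
  gcongr
  exact Finset.filter_subset_filter _ h

lemma MM_mono (σ : Measure X) (D : ι → Set X) (a : ι → ℝ≥0∞) {F G : Finset ι} (h : F ⊆ G)
    (x : X) : MM σ D a F x ≤ MM σ D a G x := by
  refine iSup₂_le fun i hi => ?_
  refine le_trans ?_ (le_iSup₂ (f := fun i (_ : i ∈ G) =>
        mm σ D a G i * (D i).indicator 1 x) i (h hi))
  gcongr
  exact mm_mono σ D a h i

def mT (σ : Measure X) (D : ι → Set X) (a : ι → ℝ≥0∞) (i : ι) : ℝ≥0∞ :=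
  (σ (D i))⁻¹ * ∑' j, if D j ⊆ D i then a j * σ (D j) else 0

lemma mT_eq (σ : Measure X) (D : ι → Set X) (a : ι → ℝ≥0∞) (i : ι) :
    mT σ D a i = ⨆ F, mm σ D a F i := by
  rw [mT, ENNReal.tsum_eq_iSup_sum, ENNReal.mul_iSup]
  refine iSup_congr fun F => ?_
  rw [mm, subF, Finset.sum_filter]

lemma lim_max [Countable ι] (σ : Measure X) (D : ι → Set X) (hm : ∀ i, MeasurableSet (D i))
    (a : ι → ℝ≥0∞) (s : ℝ) (hs : 0 < s) :
    ∫⁻ x, (⨆ (i : ι) (_ : x ∈ D i), mT σ D a i) ^ s ∂σ = ⨆ F, ∫⁻ x, (MM σ D a F x) ^ s ∂σ := by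
  rw [← lintegral_iSup_directed]
  · refine lintegral_congr fun x => ?_
    rw [← rpow_iSup_aux _ _ hs]
    congr 1
    apply le_antisymm
    · refine iSup₂_le fun i hx => ?_
      rw [mT_eq]
      refine iSup_le fun F => ?_
      refine le_trans ?_ (le_iSup _ (insert i F))
      refine le_trans ?_ (le_iSup₂ (f := fun j (_ : j ∈ insert i F) =>
        mm σ D a (insert i F) j * (D j).indicator 1 x) i (Finset.mem_insert_self _ _))
      simp only [hx, indicator_of_mem, Pi.one_apply, mul_one]
      exact mm_mono σ D a (Finset.subset_insert _ _) i
    · refine iSup_le fun F => iSup₂_le fun i hi => ?_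
      by_cases hx : x ∈ D i
      · simp only [hx, indicator_of_mem, Pi.one_apply, mul_one]
        refine le_trans ?_ (le_iSup₂ (f := fun i (_ : x ∈ D i) => mT σ D a i) i hx)
        rw [mT_eq]
        exact le_iSup (fun F => mm σ D a F i) F
      · simp [hx]
  · exact fun F => ((MM_meas σ D hm a F).pow_const _).aemeasurable
  · refine Monotone.directed_le fun F G h x => ?_
    exact ENNReal.rpow_le_rpow (MM_mono σ D a h x) hs.le

lemma lim_WW (σ : Measure X) (D : ι → Set X)
    (a : ι → ℝ≥0∞) (s : ℝ) (hs : 1 < s) :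
    ∑' i, a i * (σ (D i) * (mT σ D a i) ^ (s - 1)) = ⨆ F, WW σ D a s F := by
  apply le_antisymm
  · rw [ENNReal.tsum_eq_iSup_sum]
    refine iSup_le fun G => ?_
    simp only [mT_eq, rpow_iSup_aux _ (s - 1) (by linarith : 0 < s - 1), ENNReal.mul_iSup]
    rw [ENNReal.finsetSum_iSup_of_monotone]
    · refine iSup_le fun F => ?_
      refine le_trans ?_ (le_iSup _ (G ∪ F))
      unfold WW
      refine le_trans ?_ (Finset.sum_le_sum_of_subset (Finset.subset_union_left (s₂ := F)))
      gcongr with i hi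
      exact mm_mono σ D a Finset.subset_union_right i
    · intro i F G h
      dsimp only
      gcongr
      exact mm_mono σ D a h i
  · refine iSup_le fun F => ?_
    refine le_trans ?_ (ENNReal.sum_le_tsum F)
    unfold WW
    gcongr with i hi
    rw [mT_eq]; exact le_iSup (fun F => mm σ D a F i) F

end aux

lemma dCube_meas (n : ℕ) (q : DIdx n) : MeasurableSet (dCube n q) := by
  have : dCube n q = ⋂ i, {x : Euc n | (q.2 i : ℝ) ≤ (2:ℝ) ^ q.1 * x i ∧
      (2:ℝ) ^ q.1 * x i < (q.2 i : ℝ) + 1} := by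
    ext x; simp [dCube]
  rw [this]
  refine MeasurableSet.iInter fun i => ?_
  have hx : Measurable fun x : Euc n => (2:ℝ) ^ q.1 * x i := by fun_prop
  exact (measurableSet_le measurable_const hx).inter (measurableSet_lt hx measurable_const)

lemma dCube_bdd (n : ℕ) (q : DIdx n) : Bornology.IsBounded (dCube n q) := by
  rw [isBounded_iff_forall_norm_le]
  refine ⟨Real.sqrt (∑ i : Fin n, ((|(q.2 i : ℝ)| + 1) / (2:ℝ) ^ q.1) ^ 2), fun x hx => ?_⟩
  rw [EuclideanSpace.norm_eq]
  apply Real.sqrt_le_sqrt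
  refine Finset.sum_le_sum fun i _ => ?_
  have h2 : (0:ℝ) < (2:ℝ) ^ q.1 := by positivity
  gcongr
  rw [Real.norm_eq_abs, le_div_iff₀ h2, ← abs_of_pos h2, ← abs_mul, mul_comm]
  obtain ⟨h3, h4⟩ := hx i
  rw [abs_le]
  constructor
  · have := neg_abs_le (q.2 i : ℝ); linarith
  · have := le_abs_self (q.2 i : ℝ); linarith

lemma dCube_nest_aux (n : ℕ) (q r : DIdx n) (h : q.1 ≤ r.1) (x : Euc n) (hx : x ∈ dCube n q)
    (hx' : x ∈ dCube n r) : dCube n r ⊆ dCube n q := by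
  intro y hy i
  obtain ⟨d, hd⟩ := Int.le.dest h
  obtain ⟨a1, a2⟩ := hx i
  obtain ⟨b1, b2⟩ := hx' i
  obtain ⟨c1, c2⟩ := hy i
  have e : (2:ℝ) ^ r.1 = (2:ℝ) ^ d * (2:ℝ) ^ q.1 := by
    rw [← hd, zpow_add₀ (by norm_num), zpow_natCast, mul_comm]
  have hd0 : (0:ℝ) < (2:ℝ) ^ d := by positivity
  rw [e, mul_assoc] at b1 b2 c1 c2
  have k1 : (2:ℤ) ^ d * q.2 i < r.2 i + 1 := by
    have : (2:ℝ) ^ d * q.2 i < r.2 i + 1 := lt_of_le_of_lt (by gcongr) b2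
    exact_mod_cast this
  have k2 : r.2 i < (2:ℤ) ^ d * (q.2 i + 1) := by
    have : (r.2 i : ℝ) < (2:ℝ) ^ d * (q.2 i + 1) := lt_of_le_of_lt b1 (by gcongr)
    exact_mod_cast this
  have k1' : (2:ℝ) ^ d * q.2 i ≤ r.2 i := by exact_mod_cast Int.lt_add_one_iff.1 k1
  have k2' : (r.2 i : ℝ) + 1 ≤ (2:ℝ) ^ d * (q.2 i + 1) := by exact_mod_cast Int.add_one_le_iff.2 k2
  exact ⟨le_of_mul_le_mul_left (k1'.trans c1) hd0,
    lt_of_mul_lt_mul_left (c2.trans_le k2') hd0.le⟩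

lemma dCube_nest (n : ℕ) (q r : DIdx n) (x : Euc n) (hx : x ∈ dCube n q)
    (hx' : x ∈ dCube n r) : dCube n q ⊆ dCube n r ∨ dCube n r ⊆ dCube n q := by
  rcases le_total q.1 r.1 with h | h
  · exact Or.inr (dCube_nest_aux n q r h x hx hx')
  · exact Or.inl (dCube_nest_aux n r q h x hx' hx)

lemma Kbar_lint (n : ℕ) (σ μ : Measure (Euc n)) (K : DIdx n → ℝ≥0∞) (q : DIdx n) :
    ∫⁻ y in dCube n q, Kbar n σ K q y ∂μ =
      mT σ (dCube n) (fun r => K r * μ (dCube n r)) q := by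
  have hmeas : ∀ r : DIdx n, Measurable fun y => if dCube n r ⊆ dCube n q then
      K r * σ (dCube n r) * ch n r y else 0 := by
    intro r
    split_ifs
    · exact (measurable_one.indicator (dCube_meas n r)).const_mul _
    · exact measurable_const
  unfold Kbar mT
  rw [lintegral_const_mul _ (Measurable.ennreal_tsum hmeas),
    lintegral_tsum fun r => (hmeas r).aemeasurable]
  congr 1
  refine tsum_congr fun r => ?_
  split_ifs with h
  · unfold ch
    rw [lintegral_const_mul _ (measurable_one.indicator (dCube_meas n r)),
      lintegral_indicator_one (dCube_meas n r), Measure.restrict_apply (dCube_meas n r),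
      inter_eq_left.2 h]
    ring
  · simp

/-- For `1 < p < ∞` there is a constant `C > 0` depending only on `p`
such that for every `K : 𝒟 → [0,∞)` and all locally finite positive Borel measures
`μ, σ` on `ℝ^n`, the three quantities (a) `ℰ^𝒟_{K,σ}[μ]`, (b) `∫ 𝒲^𝒟_{K,σ}[μ] dμ`
and (c) `∫ (M^𝒟_K[μ])^{p'} dσ` are equivalent. -/
theorem stmt2 (p : ℝ) (hp : 1 < p) :
    ∃ C : ℝ, 0 < C ∧
      ∀ (n : ℕ), 0 < n → ∀ (K : DIdx n → ℝ≥0) (σ μ : Measure (Euc n)),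
        IsLocallyFiniteMeasure σ → IsLocallyFiniteMeasure μ →
          energyD n σ μ (fun q => (K q : ℝ≥0∞)) p ≤
              ENNReal.ofReal C * wolffSumD n σ μ (fun q => (K q : ℝ≥0∞)) p ∧
          wolffSumD n σ μ (fun q => (K q : ℝ≥0∞)) p ≤
              ENNReal.ofReal C *
                ∫⁻ x, (maxFnD n σ μ (fun q => (K q : ℝ≥0∞)) x) ^ (p / (p - 1)) ∂σ ∧
          (∫⁻ x, (maxFnD n σ μ (fun q => (K q : ℝ≥0∞)) x) ^ (p / (p - 1)) ∂σ) ≤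
              ENNReal.ofReal C * energyD n σ μ (fun q => (K q : ℝ≥0∞)) p := by
  have hs : 1 < p / (p - 1) := by rw [lt_div_iff₀ (by linarith)]; linarith
  set s := p / (p - 1) with hsdef
  obtain ⟨k, hk⟩ := exists_nat_ge s
  obtain ⟨C1, h1⟩ := energy_le k s hs (by linarith)
  obtain ⟨C2, h2⟩ := WW_le s hs C1
  obtain ⟨C3, h3⟩ := maxfn_le s hs
  refine ⟨((C1 + C2 + C3 + 1 : ℝ≥0) : ℝ), by positivity, ?_⟩
  intro n _ K σ μ hσ hμ
  rw [ENNReal.ofReal_coe_nnreal]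
  set a : DIdx n → ℝ≥0∞ := fun q => (K q : ℝ≥0∞) * μ (dCube n q) with ha
  have haf : ∀ q, a q ≠ ∞ := fun q =>
    ENNReal.mul_ne_top ENNReal.coe_ne_top (dCube_bdd n q).measure_lt_top.ne
  have hf : ∀ q, σ (dCube n q) ≠ ∞ := fun q => (dCube_bdd n q).measure_lt_top.ne
  have hm := dCube_meas n
  have hD := dCube_nest n
  have eE : energyD n σ μ (fun q => (K q : ℝ≥0∞)) p =
      ⨆ F, ∫⁻ x, (ff (dCube n) a F x) ^ s ∂σ :=
    lim_energy σ (dCube n) hm a s (by linarith)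
  have eW : wolffSumD n σ μ (fun q => (K q : ℝ≥0∞)) p = ⨆ F, WW σ (dCube n) a s F := by
    rw [← lim_WW σ (dCube n) a s hs, wolffSumD]
    refine tsum_congr fun q => ?_
    rw [Kbar_lint, ← hsdef]
    simp only [ha]
    ring
  have eM : (∫⁻ x, (maxFnD n σ μ (fun q => (K q : ℝ≥0∞)) x) ^ s ∂σ) =
      ⨆ F, ∫⁻ x, (MM σ (dCube n) a F x) ^ s ∂σ := by
    rw [← lim_max σ (dCube n) hm a s (by linarith)]
    refine lintegral_congr fun x => ?_
    unfold maxFnD mT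
    congr 1
    refine iSup_congr fun q => iSup_congr fun _ => ?_
    congr 1
    refine tsum_congr fun r => ?_
    split_ifs
    · simp only [ha]; ring
    · rfl
  rw [eE, eW, eM]
  refine ⟨iSup_le fun F => ?_, iSup_le fun F => ?_, iSup_le fun F => ?_⟩
  · refine (h1 _ _ σ (dCube n) hm hf hD a haf F).trans ?_
    refine mul_le_mul' ?_ (le_iSup (fun F => WW σ (dCube n) a s F) F)
    exact_mod_cast (by rw [add_assoc, add_assoc]; exact le_self_add : C1 ≤ C1 + C2 + C3 + 1)
  · refine (h2 _ _ σ (dCube n) hm hf a haf F (h1 _ _ σ (dCube n) hm hf hD a haf F)).trans ?_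
    refine mul_le_mul' ?_ (le_iSup (fun F => ∫⁻ x, (MM σ (dCube n) a F x) ^ s ∂σ) F)
    exact_mod_cast (by
      rw [add_comm C1 C2, add_assoc, add_assoc]; exact le_self_add : C2 ≤ C1 + C2 + C3 + 1)
  · refine (h3 _ _ σ (dCube n) hm hf hD a haf F).trans ?_
    refine mul_le_mul' ?_ (le_iSup (fun F => ∫⁻ x, (ff (dCube n) a F x) ^ s ∂σ) F)
    exact_mod_cast (by
      rw [add_comm (C1 + C2) C3, add_assoc]; exact le_self_add : C3 ≤ C1 + C2 + C3 + 1)
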